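/- Let {Y ∪ {Δ}, A, p} be an MDP model that is absorbing with a given initial state x0 ∈ Y and that satisfies Condition (S), and let Λ be a nonempty set of strategies. Then the MDP model is Λ-uniformly absorbing with the initial state x0 if and only if the set D^Λ_{x0} of occupation measures over Λ is relatively compact in M(Y × A) with respect to the ws-topology. -/

import Mathlib

open MeasureTheory ProbabilityTheory Filter Topology
open scoped ENNReal

noncomputable section

/-! ### General MDP framework

The state space of an absorbing-type MDP model is `X = Y ⊕ Unit`, where `Sum.inr ()` plays
the role of the isolated cemetery point `Δ` and `Y` is embedded via `Sum.inl`.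

A history up to stage `n` is `h_n = (x_0, a_1, x_1, …, a_n, x_n)`, which we encode as the
list of pairs `(x_k, a_{k+1})`, `k < n`, together with the last state `x_n`. -/

/-- The space `H_n` of histories up to stage `n`. -/
abbrev Hist (X A : Type*) (n : ℕ) : Type _ := (Fin n → X × A) × X

/-- A strategy: for every `n`, a stochastic (Markov) kernel on `A` given `H_n`,
prescribing the law of the action `a_{n+1}` given the history `h_n`. -/
def Strategy (X A : Type*) [MeasurableSpace X] [MeasurableSpace A] : Type _ :=
  {π : (n : ℕ) → Kernel (Hist X A n) A // ∀ n, IsMarkovKernel (π n)}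

variable {X A Y : Type*} [MeasurableSpace X] [MeasurableSpace A] [MeasurableSpace Y]

/-- The finite-dimensional distributions of the strategic measure `P^π_{x0}`:
`histLaw p π x0 n` is the joint law of `(X_0, A_1, …, A_n, X_n)` under `P^π_{x0}`,
built by the Ionescu-Tulcea recursion. -/
def histLaw (p : Kernel (X × A) X) (π : Strategy X A) (x0 : X) :
    (n : ℕ) → Measure (Hist X A n)
  | 0 => Measure.dirac (fun i => i.elim0, x0)
  | n + 1 =>
      (histLaw p π x0 n).bind fun h =>
        ((π.1 n) h).bind fun a =>
          (p (h.2, a)).map fun x' => (Fin.snoc h.1 (h.2, a), x')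

/-- The law of the pair `(X_n, A_{n+1})` under the strategic measure `P^π_{x0}`. -/
def pairLaw (p : Kernel (X × A) X) (π : Strategy X A) (x0 : X) (n : ℕ) :
    Measure (X × A) :=
  (histLaw p π x0 n).bind fun h => ((π.1 n) h).map fun a => (h.2, a)

/-- The occupation measure `η^π_{x0}` on `Y × A`:
`η^π_{x0}(dx × da) = Σ_n P^π_{x0}(X_n ∈ dx ∩ Y, A_{n+1} ∈ da)`. -/
def occupation (p : Kernel ((Y ⊕ Unit) × A) (Y ⊕ Unit)) (π : Strategy (Y ⊕ Unit) A)
    (x0 : Y ⊕ Unit) : Measure (Y × A) :=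
  Measure.sum fun n => (pairLaw p π x0 n).comap fun ya : Y × A => (Sum.inl ya.1, ya.2)

/-- `P^π_{x0}(X_t ∈ Y)`.  Since the cemetery `Δ` is absorbing, this equals the tail
probability `P^π_{x0}(τ > t)` of the hitting time `τ` of `Δ`. -/
def survive (p : Kernel ((Y ⊕ Unit) × A) (Y ⊕ Unit)) (π : Strategy (Y ⊕ Unit) A)
    (x0 : Y ⊕ Unit) (t : ℕ) : ℝ≥0∞ :=
  pairLaw p π x0 t {z | ∃ y : Y, z.1 = Sum.inl y}

/-- The model is absorbing with initial state `x0`: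
`E^π_{x0}[τ] = Σ_t P^π_{x0}(τ > t) < ∞` for every strategy `π`. -/
def IsAbsorbing (p : Kernel ((Y ⊕ Unit) × A) (Y ⊕ Unit)) (x0 : Y ⊕ Unit) : Prop :=
  ∀ π : Strategy (Y ⊕ Unit) A, ∑' t : ℕ, survive p π x0 t < ⊤

/-- The model is `Λ`-uniformly absorbing with initial state `x0`:
`sup_{π ∈ Λ} E^π_{x0}[Σ_{t=n}^∞ 1{τ > t}] = sup_{π ∈ Λ} Σ_{t ≥ n} P^π_{x0}(τ > t) → 0`. -/
def IsUnifAbsorbing (p : Kernel ((Y ⊕ Unit) × A) (Y ⊕ Unit))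
    (Λ : Set (Strategy (Y ⊕ Unit) A)) (x0 : Y ⊕ Unit) : Prop :=
  Tendsto (fun n : ℕ => ⨆ π ∈ Λ, ∑' t : ℕ, survive p π x0 (n + t)) atTop (𝓝 0)

/-- The set `D^Λ_{x0} ⊆ M(Y × A)` of occupation measures of strategies in `Λ`. -/
def OccSet (p : Kernel ((Y ⊕ Unit) × A) (Y ⊕ Unit)) (Λ : Set (Strategy (Y ⊕ Unit) A))
    (x0 : Y ⊕ Unit) : Set (FiniteMeasure (Y × A)) :=
  {η | ∃ π ∈ Λ, (η : Measure (Y × A)) = occupation p π x0}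

/-- Condition (S): the action space is compact and `a ↦ ∫ g dp(·|x,a)` is continuous for
every bounded measurable `g` and every state `x`. -/
def ConditionS [TopologicalSpace A] (p : Kernel (X × A) X) : Prop :=
  CompactSpace A ∧
    ∀ g : X → ℝ, Measurable g → (∃ C, ∀ x, |g x| ≤ C) →
      ∀ x : X, Continuous fun a : A => ∫ y, g y ∂(p (x, a))

/-- Condition (W): the action space is compact and `(x,a) ↦ ∫ g dp(·|x,a)` is continuous for
every bounded continuous `g`. -/
def ConditionW [TopologicalSpace X] [TopologicalSpace A] (p : Kernel (X × A) X) : Prop :=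
  CompactSpace A ∧
    ∀ g : X → ℝ, Continuous g → (∃ C, ∀ x, |g x| ≤ C) →
      Continuous fun xa : X × A => ∫ y, g y ∂(p xa)

/-- The w-topology on `M(Ω)`: the coarsest topology making `η ↦ ∫ g dη` continuous for
every bounded continuous `g : Ω → ℝ`. -/
def wTop (Ω : Type*) [TopologicalSpace Ω] [MeasurableSpace Ω] :
    TopologicalSpace (FiniteMeasure Ω) :=
  ⨅ (g : Ω → ℝ) (_ : Continuous g) (_ : ∃ C, ∀ z, |g z| ≤ C),
    TopologicalSpace.induced (fun η : FiniteMeasure Ω => ∫ z, g z ∂(η : Measure Ω))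
      inferInstance

/-- The ws-topology on `M(Y × A)`: the coarsest topology making `η ↦ ∫ g dη` continuous for
every bounded Caratheodory function `g : Y × A → ℝ`. -/
def wsTop (Y A : Type*) [MeasurableSpace Y] [TopologicalSpace A] [MeasurableSpace A] :
    TopologicalSpace (FiniteMeasure (Y × A)) :=
  ⨅ (g : Y × A → ℝ) (_ : Measurable g) (_ : ∃ C, ∀ z, |g z| ≤ C)
    (_ : ∀ y : Y, Continuous fun a : A => g (y, a)),
    TopologicalSpace.induced (fun η : FiniteMeasure (Y × A) => ∫ z, g z ∂(η : Measure (Y × A)))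
      inferInstance

/-- The s-topology on `M(Y)`: the coarsest topology making `η ↦ ∫ f dη` continuous for
every bounded measurable `f : Y → ℝ`. -/
def sTop (Y : Type*) [MeasurableSpace Y] : TopologicalSpace (FiniteMeasure Y) :=
  ⨅ (f : Y → ℝ) (_ : Measurable f) (_ : ∃ C, ∀ z, |f z| ≤ C),
    TopologicalSpace.induced (fun η : FiniteMeasure Y => ∫ z, f z ∂(η : Measure Y))
      inferInstance

/-- A family of measures that is eventually uniformly countably additive along an ultrafilter
converges setwise to a measure. -/
theorem exists_setwise_limit {ι Y : Type*} [MeasurableSpace Y] (𝒰 : Ultrafilter ι)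
    (m : ι → Measure Y)
    (huca : ∀ B : ℕ → Set Y, Antitone B → (∀ n, MeasurableSet (B n)) → ⋂ n, B n = ∅ →
      ∀ ε : ℝ≥0∞, ε ≠ 0 → ∃ k, ∀ᶠ i in (𝒰 : Filter ι), m i (B k) ≤ ε) :
    ∃ ν : Measure Y, ∀ B, MeasurableSet B →
      Tendsto (fun i => m i B) (𝒰 : Filter ι) (𝓝 (ν B)) := by
  let L : Set Y → ℝ≥0∞ := fun s => (𝒰.map fun i => m i s).lim
  have hL : ∀ s, Tendsto (fun i => m i s) (𝒰 : Filter ι) (𝓝 (L s)) := fun s =>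
    (𝒰.map fun i => m i s).le_nhds_lim
  have h0 : L ∅ = 0 := tendsto_nhds_unique (hL ∅) (by simp)
  have hU : ∀ ⦃f : ℕ → Set Y⦄, (∀ i, MeasurableSet (f i)) → Pairwise (Function.onFun Disjoint f) →
      L (⋃ i, f i) = ∑' i, L (f i) := by
    intro f hf hd
    let B : ℕ → Set Y := fun k => ⋃ n, f (n + k)
    have hsplit : ∀ k, L (⋃ i, f i) = ∑ n ∈ Finset.range k, L (f n) + L (B k) := by
      intro k
      refine tendsto_nhds_unique (hL _) ?_
      refine ((tendsto_finsetSum _ fun n _ => hL (f n)).add (hL (B k))).congr fun i => ?_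
      have hB : m i (B k) = ∑' n, m i (f (n + k)) :=
        measure_iUnion (fun a b hab => hd (by simpa using hab)) fun n => hf _
      rw [measure_iUnion hd hf, hB]
      exact Summable.sum_add_tsum_nat_add' ENNReal.summable
    apply le_antisymm
    · refine ENNReal.le_of_forall_pos_le_add fun ε hε _ => ?_
      have hanti : Antitone B := by
        intro a b hab
        refine Set.iUnion_subset fun n => ?_
        have : n + b = (n + (b - a)) + a := by omega
        rw [this]
        exact Set.subset_iUnion (fun n => f (n + a)) _
      have hempty : ⋂ n, B n = ∅ := by
        rw [Set.eq_empty_iff_forall_notMem]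
        intro y hy
        rw [Set.mem_iInter] at hy
        obtain ⟨n, hn⟩ := Set.mem_iUnion.1 (hy 0)
        obtain ⟨l, hl⟩ := Set.mem_iUnion.1 (hy (n + 1))
        exact Set.disjoint_left.1 (hd (show n + 0 ≠ l + (n + 1) by omega)) hn hl
      obtain ⟨k, hk⟩ := huca B hanti (fun k => MeasurableSet.iUnion fun n => hf _) hempty ε
        (by simpa using hε.ne')
      rw [hsplit k]
      exact add_le_add (ENNReal.sum_le_tsum _) (le_of_tendsto (hL _) hk)
    · rw [ENNReal.tsum_eq_iSup_nat]
      refine iSup_le fun k => ?_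
      rw [hsplit k]
      exact le_self_add
  refine ⟨Measure.ofMeasurable (fun s _ => L s) h0 (fun f hf hd => hU hf hd), fun B hB => ?_⟩
  rw [Measure.ofMeasurable_apply B hB]
  exact hL B

theorem stronglyMeasurable_curry_of_caratheodory {Y A : Type*} [MeasurableSpace Y]
    [TopologicalSpace A] [MeasurableSpace A] [CompactSpace A]
    [TopologicalSpace.MetrizableSpace A] {g : Y × A → ℝ} (hg : Measurable g)
    (hc : ∀ y, Continuous fun a => g (y, a)) :
    StronglyMeasurable fun y => (⟨fun a => g (y, a), hc y⟩ : C(A, ℝ)) := by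
  borelize C(A, ℝ)
  set F : Y → C(A, ℝ) := fun y => ⟨fun a => g (y, a), hc y⟩ with hF
  have hdist : ∀ f : C(A, ℝ), Measurable fun y => dist (F y) f := by
    intro f
    refine measurable_of_Iic fun r => ?_
    rcases lt_or_ge r 0 with hr | hr
    · convert MeasurableSet.empty
      ext y
      simpa using hr.trans_le dist_nonneg
    · obtain ⟨D, hDc, hDd⟩ := TopologicalSpace.exists_countable_dense A
      have : (fun y => dist (F y) f) ⁻¹' Set.Iic r = ⋂ a ∈ D, {y | dist (g (y, a)) (f a) ≤ r} := by
        ext y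
        simp only [Set.mem_preimage, Set.mem_Iic, ContinuousMap.dist_le hr, Set.mem_iInter,
          Set.mem_ofPred_eq]
        refine ⟨fun h a _ => h a, fun h a => ?_⟩
        have hcl : IsClosed {a | dist (F y a) (f a) ≤ r} :=
          isClosed_le ((F y).continuous.dist f.continuous) continuous_const
        exact hcl.closure_subset_iff.2 h (hDd a)
      rw [this]
      refine MeasurableSet.biInter hDc fun a _ => ?_
      exact measurableSet_le ((hg.comp (measurable_id.prodMk measurable_const)).dist
        measurable_const) measurable_const
  refine Measurable.stronglyMeasurable ?_
  refine measurable_of_isOpen fun U hU => ?_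
  obtain ⟨D, hDc, hDd⟩ := TopologicalSpace.exists_countable_dense C(A, ℝ)
  have : F ⁻¹' U = ⋃ f ∈ D, ⋃ q : ℚ, ⋃ (_ : Metric.ball f q ⊆ U), {y | dist (F y) f < q} := by
    ext y
    simp only [Set.mem_preimage, Set.mem_iUnion, Set.mem_ofPred_eq, exists_prop]
    constructor
    · intro hy
      obtain ⟨ε, hε, hball⟩ := Metric.isOpen_iff.1 hU _ hy
      obtain ⟨f, hfD, hf⟩ := Metric.dense_iff.1 hDd (F y) (ε / 2) (by positivity)
      obtain ⟨q, hq1, hq2⟩ := exists_rat_btwn (Metric.mem_ball'.1 hfD)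
      refine ⟨f, hf, q, fun z hz => hball ?_, hq1⟩
      rw [Metric.mem_ball] at hz ⊢
      have h1 := Metric.mem_ball.1 hfD
      calc dist z (F y) ≤ dist z f + dist f (F y) := dist_triangle _ _ _
        _ < ε / 2 + ε / 2 := by linarith
        _ = ε := by ring
    · rintro ⟨f, _, q, hsub, hlt⟩
      exact hsub hlt
  rw [this]
  exact MeasurableSet.biUnion hDc fun f _ => MeasurableSet.iUnion fun q =>
    MeasurableSet.iUnion fun _ => measurableSet_lt (hdist f) measurable_const

/-- A compactness criterion for the ws-topology on a product of compact spaces. -/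
theorem exists_ws_limit_of_compactSpace {ι Y A : Type*}
    [TopologicalSpace Y] [MeasurableSpace Y] [BorelSpace Y] [CompactSpace Y]
    [TopologicalSpace.MetrizableSpace Y] [SecondCountableTopology Y]
    [TopologicalSpace A] [MeasurableSpace A] [BorelSpace A] [CompactSpace A]
    [TopologicalSpace.MetrizableSpace A] [SecondCountableTopology A]
    (𝒰 : Ultrafilter ι) (θ : ι → FiniteMeasure (Y × A)) (C : NNReal)
    (hC : ∀ᶠ i in (𝒰 : Filter ι), (θ i).mass ≤ C)
    (huca : ∀ B : ℕ → Set Y, Antitone B → (∀ n, MeasurableSet (B n)) → ⋂ n, B n = ∅ →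
      ∀ ε : ℝ≥0∞, ε ≠ 0 →
        ∃ k, ∀ᶠ i in (𝒰 : Filter ι), (θ i : Measure (Y × A)) (B k ×ˢ Set.univ) ≤ ε) :
    ∃ η : FiniteMeasure (Y × A), ∀ g : Y × A → ℝ, Measurable g → (∃ K, ∀ z, |g z| ≤ K) →
      (∀ y, Continuous fun a => g (y, a)) →
      Tendsto (fun i => ∫ z, g z ∂(θ i : Measure (Y × A))) (𝒰 : Filter ι)
        (𝓝 (∫ z, g z ∂(η : Measure (Y × A)))) := by
  have hfst : ∀ (μ : Measure (Y × A)) (B : Set Y), MeasurableSet B →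
      μ.fst B = μ (B ×ˢ Set.univ) := fun μ B hB => by
    rw [Measure.fst_apply hB]; congr 1; ext; simp
  obtain ⟨ν, hν⟩ := exists_setwise_limit 𝒰 (fun i => (θ i : Measure (Y × A)).fst) (by
    intro B h1 h2 h3 ε hε
    obtain ⟨k, hk⟩ := huca B h1 h2 h3 ε hε
    exact ⟨k, hk.mono fun i hi => by rwa [hfst _ _ (h2 k)]⟩)
  have hmass : ∀ i, (θ i).mass ≤ C → (θ i : Measure (Y × A)) Set.univ ≤ C := fun i hi => by
    rw [← FiniteMeasure.ennreal_mass]; exact_mod_cast hi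
  have hνC : ν Set.univ ≤ C := by
    refine le_of_tendsto (hν _ MeasurableSet.univ) (hC.mono fun i hi => ?_)
    rw [Measure.fst_univ]
    exact hmass i hi
  have : IsFiniteMeasure ν := ⟨hνC.trans_lt ENNReal.coe_lt_top⟩
  obtain ⟨η, hη, hlim⟩ := (isCompact_iff_ultrafilter_le_nhds.1
    (isCompact_setOfPred_finiteMeasure_le_of_compactSpace (Y × A) C)) (𝒰.map θ)
    (le_principal_iff.2 hC)
  have hlim : Tendsto θ (𝒰 : Filter ι) (𝓝 η) := hlim
  have hηC : (η : Measure (Y × A)) Set.univ ≤ C := by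
    rw [← FiniteMeasure.ennreal_mass]; exact_mod_cast hη
  -- the first marginal of the weak limit is dominated by the setwise limit
  have hopen : ∀ U : Set Y, IsOpen U → (η : Measure (Y × A)).fst U ≤ ν U := by
    intro U hU
    have hcl := FiniteMeasure.limsup_measure_closed_le_of_tendsto hlim
      (hU.isClosed_compl.prod (isClosed_univ (X := A)))
    have hT : Tendsto (fun i => (θ i : Measure (Y × A)) (Uᶜ ×ˢ Set.univ)) (𝒰 : Filter ι)
        (𝓝 (ν Uᶜ)) :=
      (hν Uᶜ hU.measurableSet.compl).congr fun i => hfst _ _ hU.measurableSet.compl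
    rw [hT.limsup_eq, ← hfst _ _ hU.measurableSet.compl] at hcl
    have hm : (η : Measure (Y × A)).fst Set.univ = ν Set.univ := by
      refine tendsto_nhds_unique ?_ (hν _ MeasurableSet.univ)
      simp only [Measure.fst_univ, ← FiniteMeasure.ennreal_mass]
      exact ENNReal.tendsto_coe.2 ((FiniteMeasure.continuous_mass.tendsto η).comp hlim)
    have e1 := measure_add_measure_compl (μ := (η : Measure (Y × A)).fst) hU.measurableSet
    have e2 := measure_add_measure_compl (μ := ν) hU.measurableSet
    rw [hm, ← e2] at e1
    have : (η : Measure (Y × A)).fst U + ν Uᶜ ≤ ν U + ν Uᶜ := by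
      rw [← e1]; gcongr
    exact (ENNReal.add_le_add_iff_right (measure_ne_top _ _)).1 this
  have hle : (η : Measure (Y × A)).fst ≤ ν := by
    refine Measure.le_intro fun B _ _ => ?_
    refine ENNReal.le_of_forall_pos_le_add fun ε hε _ => ?_
    obtain ⟨U, hBU, hU, hlt⟩ := B.exists_isOpen_lt_add (μ := ν) (measure_ne_top _ _)
      (ε := ε) (by simpa using hε.ne')
    exact (measure_mono hBU).trans ((hopen U hU).trans hlt.le)
  refine ⟨η, fun g hg ⟨K, hK⟩ hc => ?_⟩
  -- a jointly continuous approximation of `g`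
  let F : Y → C(A, ℝ) := fun y => ⟨fun a => g (y, a), hc y⟩
  have hFm : StronglyMeasurable F := stronglyMeasurable_curry_of_caratheodory hg hc
  have hK0 : 0 ≤ K ∨ IsEmpty (Y × A) := by
    rcases isEmpty_or_nonempty (Y × A) with h | ⟨⟨z⟩⟩
    · exact Or.inr h
    · exact Or.inl ((abs_nonneg _).trans (hK z))
  rcases hK0 with hK0 | hE
  swap
  · simp [Measure.eq_zero_of_isEmpty]
  have hFint : Integrable F ν := by
    refine Integrable.of_bound hFm.aestronglyMeasurable K (ae_of_all _ fun y => ?_)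
    exact (ContinuousMap.norm_le _ hK0).2 fun a => hK (y, a)
  have key : ∀ δ : ℝ, 0 < δ → ∃ G : Y × A → ℝ, Continuous G ∧ (∀ z, |G z| ≤ K) ∧
      ∃ B : Set Y, MeasurableSet B ∧ ν B ≤ ENNReal.ofReal δ ∧
        ∀ y ∉ B, ∀ a, |g (y, a) - G (y, a)| ≤ δ := by
    intro δ hδ
    obtain ⟨G, hG, -⟩ := hFint.exists_boundedContinuous_lintegral_sub_le
      (ε := ENNReal.ofReal δ * ENNReal.ofReal δ) (by simp [hδ])
    have hm : StronglyMeasurable fun y => F y - G y :=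
      hFm.sub G.continuous.stronglyMeasurable
    refine ⟨fun z => max (-K) (min K (G z.1 z.2)), ?_, ?_,
      {y | ENNReal.ofReal δ ≤ ‖F y - G y‖ₑ}, measurableSet_le measurable_const hm.enorm, ?_, ?_⟩
    · have : Continuous fun z : Y × A => G z.1 z.2 :=
        (G.continuous.comp continuous_fst).eval continuous_snd
      fun_prop
    · intro z
      rw [abs_le]
      exact ⟨le_max_left _ _, max_le (by linarith) (min_le_left _ _)⟩
    · have := (mul_meas_ge_le_lintegral hm.enorm (ENNReal.ofReal δ) (μ := ν)).trans hG
      exact (ENNReal.mul_le_mul_iff_right (by simpa using hδ) ENNReal.ofReal_ne_top).1 this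
    · intro y hy a
      simp only [Set.mem_ofPred_eq, not_le] at hy
      have h1 : ‖F y - G y‖ < δ := by
        rw [← ofReal_norm] at hy
        exact (ENNReal.ofReal_lt_ofReal_iff hδ).1 hy
      have h2 : |g (y, a) - G y a| < δ :=
        ((F y - G y).norm_coe_le_norm a).trans_lt h1
      have h3 := abs_le.1 (hK (y, a))
      refine le_trans ?_ h2.le
      have h4 : max (-K) (min K (g (y, a))) = g (y, a) := by
        rw [min_eq_right h3.2, max_eq_right h3.1]
      calc |g (y, a) - max (-K) (min K (G y a))|
          = |max (-K) (min K (g (y, a))) - max (-K) (min K (G y a))| := by rw [h4]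
        _ ≤ |min K (g (y, a)) - min K (G y a)| := by
            simpa using abs_max_sub_max_le_max (-K) (min K (g (y, a))) (-K) (min K (G y a))
        _ ≤ |g (y, a) - G y a| := by
            simpa using abs_min_sub_min_le_max K (g (y, a)) K (G y a)
  have hest : ∀ (μ : Measure (Y × A)) [IsFiniteMeasure μ] (δ : ℝ) (G : Y × A → ℝ) (B : Set Y),
      0 < δ → μ Set.univ ≤ C → Continuous G → (∀ z, |G z| ≤ K) → MeasurableSet B →
      μ.fst B ≤ ENNReal.ofReal (2 * δ) → (∀ y ∉ B, ∀ a, |g (y, a) - G (y, a)| ≤ δ) →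
      |∫ z, g z ∂μ - ∫ z, G z ∂μ| ≤ δ * (C + 4 * K) := by
    intro μ _ δ G B hδ hμC hGc hGK hB hμB hgG
    have hgi : Integrable g μ :=
      Integrable.of_bound hg.aestronglyMeasurable K (ae_of_all _ hK)
    have hGi : Integrable G μ :=
      Integrable.of_bound hGc.measurable.aestronglyMeasurable K (ae_of_all _ hGK)
    have hBm : MeasurableSet (B ×ˢ (Set.univ : Set A)) := hB.prod MeasurableSet.univ
    rw [← integral_sub hgi hGi]
    refine (abs_integral_le_integral_abs).trans ?_
    have hind : Integrable ((B ×ˢ (Set.univ : Set A)).indicator fun _ => 2 * K) μ :=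
      (integrable_const _).indicator hBm
    calc ∫ z, |g z - G z| ∂μ
        ≤ ∫ z, (δ + (B ×ˢ (Set.univ : Set A)).indicator (fun _ => 2 * K) z) ∂μ := by
          refine integral_mono (hgi.sub hGi).abs ((integrable_const _).add hind) fun z => ?_
          by_cases hz : z.1 ∈ B
          · have : z ∈ B ×ˢ (Set.univ : Set A) := ⟨hz, trivial⟩
            simp only [Set.indicator_of_mem this]
            have := abs_sub (g z) (G z)
            linarith [hK z, hGK z]
          · have : z ∉ B ×ˢ (Set.univ : Set A) := fun h => hz h.1
            simp only [Set.indicator_of_notMem this, add_zero]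
            exact hgG z.1 hz z.2
      _ = δ * μ.real Set.univ + 2 * K * μ.real (B ×ˢ Set.univ) := by
          rw [integral_add (integrable_const _) hind, integral_indicator hBm]
          simp [mul_comm]
      _ ≤ δ * C + 2 * K * (2 * δ) := by
          gcongr
          · exact ENNReal.toReal_le_of_le_ofReal C.2 (by simpa using hμC)
          · refine ENNReal.toReal_le_of_le_ofReal (by positivity) ?_
            rwa [← hfst _ _ hB]
      _ = δ * (C + 4 * K) := by ring
  rw [Metric.tendsto_nhds]
  intro ε hε
  have hC0 : (0 : ℝ) ≤ C := C.2
  set δ : ℝ := ε / (4 * (C + 4 * K + 1)) with hδdef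
  have hδ : 0 < δ := by positivity
  have hδε : δ * (C + 4 * K) ≤ ε / 4 := by
    rw [hδdef, div_mul_eq_mul_div, div_le_div_iff₀ (by positivity) (by norm_num)]
    nlinarith
  obtain ⟨G, hGc, hGK, B, hB, hνB, hgG⟩ := key δ hδ
  have hδ2 : ENNReal.ofReal δ < ENNReal.ofReal (2 * δ) :=
    (ENNReal.ofReal_lt_ofReal_iff (by positivity)).2 (by linarith)
  have hG := FiniteMeasure.tendsto_iff_forall_integral_tendsto.1 hlim
    (BoundedContinuousFunction.ofNormedAddCommGroup G hGc K hGK)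
  simp only [BoundedContinuousFunction.coe_ofNormedAddCommGroup] at hG
  filter_upwards [hC, (hν B hB).eventually_lt_const (hνB.trans_lt hδ2),
    Metric.tendsto_nhds.1 hG (ε / 4) (by positivity)] with i h1 h2 h3
  have e1 := hest (θ i) δ G B hδ (hmass i h1) hGc hGK hB h2.le hgG
  have e2 := hest η δ G B hδ hηC hGc hGK hB ((hle B).trans (hνB.trans hδ2.le)) hgG
  rw [Real.dist_eq] at h3 ⊢
  have h3 := abs_lt.1 h3
  have e1 := abs_le.1 e1
  have e2 := abs_le.1 e2
  rw [abs_lt]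
  constructor <;> linarith [h3.1, h3.2, e1.1, e1.2, e2.1, e2.2]

theorem abs_indicator_one_le_one {Z : Type*} (s : Set Z) (z : Z) :
    |s.indicator (1 : Z → ℝ) z| ≤ 1 := by
  by_cases hz : z ∈ s <;> simp [hz]

theorem continuous_indicator_prod_univ {Y A : Type*} [TopologicalSpace A] (B : Set Y) (y : Y) :
    Continuous fun a : A => (B ×ˢ (Set.univ : Set A)).indicator (1 : Y × A → ℝ) (y, a) := by
  by_cases hy : y ∈ B
  · have : (fun a : A => (B ×ˢ (Set.univ : Set A)).indicator (1 : Y × A → ℝ) (y, a)) =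
        fun _ => 1 := funext fun a => Set.indicator_of_mem (by exact ⟨hy, trivial⟩) _
    rw [this]
    exact continuous_const
  · have : (fun a : A => (B ×ˢ (Set.univ : Set A)).indicator (1 : Y × A → ℝ) (y, a)) =
        fun _ => 0 := funext fun a => Set.indicator_of_notMem (fun h => hy h.1) _
    rw [this]
    exact continuous_const

/-- A bounded family of finite measures on `Y × A`, with `A` compact, whose first marginals are
uniformly countably additive along an ultrafilter has a limit for the ws-topology. -/
theorem exists_ws_limit {ι Y A : Type*} [MeasurableSpace Y] [StandardBorelSpace Y]
    [TopologicalSpace A] [MeasurableSpace A] [BorelSpace A] [CompactSpace A]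
    [TopologicalSpace.MetrizableSpace A] [SecondCountableTopology A]
    (𝒰 : Ultrafilter ι) (θ : ι → FiniteMeasure (Y × A)) (C : NNReal)
    (hC : ∀ᶠ i in (𝒰 : Filter ι), (θ i).mass ≤ C)
    (huca : ∀ B : ℕ → Set Y, Antitone B → (∀ n, MeasurableSet (B n)) → ⋂ n, B n = ∅ →
      ∀ ε : ℝ≥0∞, ε ≠ 0 →
        ∃ k, ∀ᶠ i in (𝒰 : Filter ι), (θ i : Measure (Y × A)) (B k ×ˢ Set.univ) ≤ ε) :
    ∃ η : FiniteMeasure (Y × A), ∀ g : Y × A → ℝ, Measurable g → (∃ K, ∀ z, |g z| ≤ K) →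
      (∀ y, Continuous fun a => g (y, a)) →
      Tendsto (fun i => ∫ z, g z ∂(θ i : Measure (Y × A))) (𝒰 : Filter ι)
        (𝓝 (∫ z, g z ∂(η : Measure (Y × A)))) := by
  obtain ⟨e₀, he₀⟩ := exists_measurableEmbedding_real Y
  obtain ⟨e, he⟩ : ∃ e : Y → EReal, MeasurableEmbedding e :=
    ⟨_, EReal.isOpenEmbedding_coe.measurableEmbedding.comp he₀⟩
  let E : Y × A → EReal × A := Prod.map e id
  have hE : MeasurableEmbedding E := he.prodMap MeasurableEmbedding.id
  have hmap : ∀ i, ((θ i).map E : Measure (EReal × A)) = (θ i : Measure (Y × A)).map E :=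
    fun i => FiniteMeasure.toMeasure_map _ _
  obtain ⟨η, hη⟩ := exists_ws_limit_of_compactSpace 𝒰 (fun i => (θ i).map E) C
    (hC.mono fun i hi => by
      have : ((θ i).map E).mass = (θ i).mass := by
        rw [← ENNReal.coe_inj, FiniteMeasure.ennreal_mass, FiniteMeasure.ennreal_mass, hmap,
          hE.map_apply, Set.preimage_univ]
      rw [this]
      exact hi) (by
    intro B h1 h2 h3 ε hε
    obtain ⟨k, hk⟩ := huca (fun k => e ⁻¹' B k) (fun a b hab => Set.preimage_mono (h1 hab))
      (fun k => he.measurable (h2 k)) (by rw [← Set.preimage_iInter, h3, Set.preimage_empty]) ε hε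
    refine ⟨k, hk.mono fun i hi => ?_⟩
    rw [hmap, hE.map_apply]
    convert hi using 2
    ext z
    simp [E])
  have hrange : (Set.range E)ᶜ = (Set.range e)ᶜ ×ˢ Set.univ := by
    ext z
    simp [E, Set.range_prodMap]
  have hnull : (η : Measure (EReal × A)) (Set.range E)ᶜ = 0 := by
    have h := hη ((Set.range E)ᶜ.indicator 1)
      (measurable_one.indicator hE.measurableSet_range.compl)
      ⟨1, abs_indicator_one_le_one _⟩ (by
        rw [hrange]
        exact continuous_indicator_prod_univ _)
    have h0 : ∀ i, ∫ z, (Set.range E)ᶜ.indicator (1 : EReal × A → ℝ) z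
        ∂((θ i).map E : Measure (EReal × A)) = 0 := by
      intro i
      rw [hmap, hE.integral_map]
      simp
    simp only [h0] at h
    have h1 := tendsto_nhds_unique h tendsto_const_nhds
    rw [integral_indicator_one hE.measurableSet_range.compl] at h1
    exact (measureReal_eq_zero_iff).1 h1
  have hmc : ((η : Measure (EReal × A)).comap E).map E = η := by
    rw [hE.map_comap, Measure.restrict_eq_self_of_ae_mem]
    exact mem_ae_iff.2 hnull
  have hfin : IsFiniteMeasure ((η : Measure (EReal × A)).comap E) := by
    refine ⟨?_⟩
    rw [hE.comap_apply]
    exact measure_lt_top _ _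
  refine ⟨⟨(η : Measure (EReal × A)).comap E, hfin⟩, fun g hg ⟨K, hK⟩ hc => ?_⟩
  have hK' : ∀ z, |Function.extend E g 0 z| ≤ max K 0 := by
    intro z
    by_cases hz : ∃ w, E w = z
    · obtain ⟨w, rfl⟩ := hz
      rw [hE.injective.extend_apply]
      exact (hK w).trans (le_max_left _ _)
    · rw [Function.extend_apply' _ _ _ hz]
      simp
  have h := hη (Function.extend E g 0) (hE.measurable_extend hg measurable_zero) ⟨_, hK'⟩ (by
    intro y
    by_cases hy : ∃ x, e x = y
    · obtain ⟨x, rfl⟩ := hy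
      convert hc x using 2 with a
      exact hE.injective.extend_apply g 0 (x, a)
    · convert (continuous_const : Continuous fun _ : A => (0 : ℝ)) using 2 with a
      refine Function.extend_apply' _ _ _ ?_
      rintro ⟨w, hw⟩
      exact hy ⟨w.1, congrArg Prod.fst hw⟩)
  have hpull : ∀ μ : Measure (Y × A), ∫ z, Function.extend E g 0 z ∂(μ.map E) = ∫ z, g z ∂μ := by
    intro μ
    rw [hE.integral_map]
    simp only [hE.injective.extend_apply]
  have e2 : ∫ z, Function.extend E g 0 z ∂(η : Measure (EReal × A))
      = ∫ z, g z ∂((η : Measure (EReal × A)).comap E) := by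
    rw [← hpull, hmc]
  rw [e2] at h
  refine h.congr fun i => ?_
  rw [hmap, hpull]

/-- Evaluation against a bounded Caratheodory function is continuous for the ws-topology. -/
theorem continuous_integral_wsTop {Y A : Type*} [MeasurableSpace Y] [TopologicalSpace A]
    [MeasurableSpace A] {g : Y × A → ℝ} (hg : Measurable g) (hb : ∃ C, ∀ z, |g z| ≤ C)
    (hc : ∀ y, Continuous fun a => g (y, a)) :
    @Continuous _ _ (wsTop Y A) _
      fun η : FiniteMeasure (Y × A) => ∫ z, g z ∂(η : Measure (Y × A)) := by
  rw [continuous_iff_le_induced]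
  exact (iInf_le_of_le g <| iInf_le_of_le hg <| iInf_le_of_le hb <| iInf_le _ hc)

theorem le_nhds_wsTop {Y A : Type*} [MeasurableSpace Y] [TopologicalSpace A]
    [MeasurableSpace A] {l : Filter (FiniteMeasure (Y × A))} {η : FiniteMeasure (Y × A)}
    (h : ∀ g : Y × A → ℝ, Measurable g → (∃ C, ∀ z, |g z| ≤ C) →
      (∀ y, Continuous fun a => g (y, a)) →
      Tendsto (fun μ : FiniteMeasure (Y × A) => ∫ z, g z ∂(μ : Measure (Y × A))) l
        (𝓝 (∫ z, g z ∂(η : Measure (Y × A))))) :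
    l ≤ @nhds _ (wsTop Y A) η := by
  unfold wsTop
  simp only [nhds_iInf, nhds_induced, le_iInf_iff]
  exact fun g hg hb hc => tendsto_iff_comap.1 (h g hg hb hc)

theorem continuous_measureReal_prod_univ_wsTop {Y A : Type*} [MeasurableSpace Y]
    [TopologicalSpace A] [MeasurableSpace A] {B : Set Y} (hB : MeasurableSet B) :
    @Continuous _ _ (wsTop Y A) _
      fun η : FiniteMeasure (Y × A) => (η : Measure (Y × A)).real (B ×ˢ Set.univ) := by
  have hm : MeasurableSet (B ×ˢ (Set.univ : Set A)) := hB.prod MeasurableSet.univ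
  simp only [← integral_indicator_one hm]
  exact continuous_integral_wsTop (measurable_one.indicator hm)
    ⟨1, abs_indicator_one_le_one _⟩ (continuous_indicator_prod_univ B)

/-- Relative ws-compactness is equivalent to boundedness together with uniform countable additivity
of the first marginals. -/
theorem isCompact_closure_wsTop_iff {Y A : Type*} [MeasurableSpace Y] [StandardBorelSpace Y]
    [TopologicalSpace A] [MeasurableSpace A] [BorelSpace A] [CompactSpace A]
    [TopologicalSpace.MetrizableSpace A] [SecondCountableTopology A]
    (M : Set (FiniteMeasure (Y × A))) :
    @IsCompact _ (wsTop Y A) (@closure _ (wsTop Y A) M) ↔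
      (∃ C : NNReal, ∀ η ∈ M, (η : Measure (Y × A)) Set.univ ≤ C) ∧
      ∀ B : ℕ → Set Y, Antitone B → (∀ n, MeasurableSet (B n)) → ⋂ n, B n = ∅ →
        ∀ ε : ℝ≥0∞, ε ≠ 0 → ∃ k, ∀ η ∈ M, (η : Measure (Y × A)) (B k ×ˢ Set.univ) ≤ ε := by
  let := wsTop Y A
  have hconv : ∀ (η : FiniteMeasure (Y × A)) (s : Set (Y × A)) (r : NNReal),
      (η : Measure (Y × A)) s ≤ r ↔ (η : Measure (Y × A)).real s ≤ r := by
    intro η s r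
    rw [Measure.real, ← ENNReal.toReal_le_toReal (measure_ne_top _ _) ENNReal.coe_ne_top,
      ENNReal.coe_toReal]
  have hmassc : Continuous fun η : FiniteMeasure (Y × A) =>
      (η : Measure (Y × A)).real Set.univ := by
    simpa using continuous_measureReal_prod_univ_wsTop (A := A) (MeasurableSet.univ (α := Y))
  constructor
  · intro hK
    constructor
    · obtain ⟨r, hr⟩ := (hK.image hmassc).bddAbove
      refine ⟨r.toNNReal, fun η hη => (hconv _ _ _).2 ?_⟩
      exact (hr ⟨η, subset_closure hη, rfl⟩).trans (Real.le_coe_toNNReal r)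
    · intro B hB1 hB2 hB3 ε hε
      obtain ⟨r, hr0, hrε⟩ := ENNReal.lt_iff_exists_nnreal_btwn.1 (pos_iff_ne_zero.2 hε)
      have hr0 : 0 < r := by exact_mod_cast hr0
      obtain ⟨k, hk⟩ := hK.elim_directed_cover
        (fun k => {η | (η : Measure (Y × A)).real (B k ×ˢ Set.univ) < r})
        (fun k => isOpen_lt (continuous_measureReal_prod_univ_wsTop (hB2 k)) continuous_const) (by
          intro η _
          have ht : Tendsto (fun k => (η : Measure (Y × A)) (B k ×ˢ Set.univ)) atTop (𝓝 0) := by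
            have := tendsto_measure_iInter_atTop (μ := (η : Measure (Y × A)))
              (s := fun k => B k ×ˢ (Set.univ : Set A))
              (fun k => ((hB2 k).prod MeasurableSet.univ).nullMeasurableSet)
              (fun a b hab => Set.prod_mono (hB1 hab) subset_rfl) ⟨0, measure_ne_top _ _⟩
            have hI : ⋂ k, B k ×ˢ (Set.univ : Set A) = ∅ := by
              rw [Set.eq_empty_iff_forall_notMem]
              intro z hz
              have : z.1 ∈ ⋂ k, B k := Set.mem_iInter.2 fun k => (Set.mem_iInter.1 hz k).1
              simp [hB3] at this
            rwa [hI, measure_empty] at this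
          obtain ⟨k, hk⟩ := (ht.eventually_lt_const
            (show (0 : ℝ≥0∞) < r by exact_mod_cast hr0)).exists
          refine Set.mem_iUnion.2 ⟨k, ?_⟩
          exact (ENNReal.toReal_lt_of_lt_ofReal (by simpa using hk)))
        (Monotone.directed_le fun a b hab η hη => lt_of_le_of_lt
          (measureReal_mono (Set.prod_mono (hB1 hab) subset_rfl)) hη)
      refine ⟨k, fun η hη => ((hconv _ _ _).2 ?_).trans hrε.le⟩
      exact (hk (subset_closure hη)).le
  · rintro ⟨⟨C, hC⟩, huca⟩
    have hcl : ∀ (B : Set Y) (r : NNReal), MeasurableSet B →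
        (∀ η ∈ M, (η : Measure (Y × A)) (B ×ˢ Set.univ) ≤ r) →
        ∀ η ∈ closure M, (η : Measure (Y × A)) (B ×ˢ Set.univ) ≤ r := by
      intro B r hB h η hη
      rw [hconv]
      exact closure_minimal (t := {η : FiniteMeasure (Y × A) | (η : Measure (Y × A)).real (B ×ˢ Set.univ) ≤ r})
        (fun η hη => (hconv _ _ _).1 (h η hη))
        (isClosed_le (continuous_measureReal_prod_univ_wsTop hB) continuous_const) hη
    rw [isCompact_iff_ultrafilter_le_nhds]
    intro 𝒰 h𝒰
    rw [le_principal_iff] at h𝒰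
    obtain ⟨η, hη⟩ := exists_ws_limit 𝒰 id C
      (by
        filter_upwards [h𝒰] with η hη
        have := hcl Set.univ C MeasurableSet.univ (by simpa using hC) η hη
        rw [Set.univ_prod_univ, ← FiniteMeasure.ennreal_mass] at this
        exact_mod_cast this) (by
      intro B hB1 hB2 hB3 ε hε
      obtain ⟨r, hr0, hrε⟩ := ENNReal.lt_iff_exists_nnreal_btwn.1 (pos_iff_ne_zero.2 hε)
      obtain ⟨k, hk⟩ := huca B hB1 hB2 hB3 r hr0.ne'
      refine ⟨k, ?_⟩
      filter_upwards [h𝒰] with η hη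
      exact (hcl (B k) r (hB2 k) hk η hη).trans hrε.le)
    have hle : (𝒰 : Filter (FiniteMeasure (Y × A))) ≤ 𝓝 η := le_nhds_wsTop hη
    exact ⟨η, isClosed_closure.mem_of_tendsto (f := id) hle h𝒰, hle⟩

section HistoryLaws

variable {X A : Type*} [MeasurableSpace X] [MeasurableSpace A]

theorem measurable_histSnoc (n : ℕ) :
    Measurable fun q : (Hist X A n × A) × X =>
      ((Fin.snoc q.1.1.1 (q.1.1.2, q.1.2), q.2) : Hist X A (n + 1)) := by
  refine Measurable.prodMk ?_ measurable_snd
  refine measurable_pi_iff.2 fun i => ?_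
  refine Fin.lastCases ?_ (fun j => ?_) i
  · simp only [Fin.snoc_last]
    fun_prop
  · simp only [Fin.snoc_castSucc]
    fun_prop

theorem measurable_histSnoc_right {n : ℕ} (h : Hist X A n) (a : A) :
    Measurable fun x' : X => ((Fin.snoc h.1 (h.2, a), x') : Hist X A (n + 1)) :=
  (measurable_histSnoc n).comp (measurable_prodMk_left (x := (h, a)))

theorem measurable_transition_map (p : Kernel (X × A) X) [IsMarkovKernel p] (n : ℕ) :
    Measurable fun q : Hist X A n × A => (p (q.1.2, q.2)).map fun x' =>
      ((Fin.snoc q.1.1 (q.1.2, q.2), x') : Hist X A (n + 1)) := by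
  have hc : Measurable fun q : Hist X A n × A => (q.1.2, q.2) := by fun_prop
  refine Measure.measurable_of_measurable_coe _ fun s hs => ?_
  have : ∀ q : Hist X A n × A, ((p (q.1.2, q.2)).map fun x' =>
      ((Fin.snoc q.1.1 (q.1.2, q.2), x') : Hist X A (n + 1))) s =
      p.comap _ hc q (Prod.mk q ⁻¹' ((fun q : (Hist X A n × A) × X =>
      ((Fin.snoc q.1.1.1 (q.1.1.2, q.1.2), q.2) : Hist X A (n + 1))) ⁻¹' s)) := by
    intro q
    exact Measure.map_apply (measurable_histSnoc_right q.1 q.2) hs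
  simp only [this]
  exact Kernel.measurable_kernel_prodMk_left (measurable_histSnoc n hs)

theorem measurable_hist_step (p : Kernel (X × A) X) [IsMarkovKernel p] (π : Strategy X A) (n : ℕ) :
    Measurable fun h : Hist X A n => ((π.1 n) h).bind fun a =>
      (p (h.2, a)).map fun x' => ((Fin.snoc h.1 (h.2, a), x') : Hist X A (n + 1)) := by
  have := π.2 n
  refine Measure.measurable_of_measurable_coe _ fun s hs => ?_
  have hm := measurable_transition_map p n
  have : ∀ h : Hist X A n, (((π.1 n) h).bind fun a =>
      (p (h.2, a)).map fun x' => ((Fin.snoc h.1 (h.2, a), x') : Hist X A (n + 1))) s =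
      ∫⁻ a, ((p (h.2, a)).map fun x' => ((Fin.snoc h.1 (h.2, a), x') : Hist X A (n + 1))) s
        ∂(π.1 n h) := fun h =>
    Measure.bind_apply hs (hm.comp measurable_prodMk_left).aemeasurable
  simp only [this]
  exact ((Measure.measurable_coe hs).comp hm).lintegral_kernel_prod_right'

theorem lintegral_pairLaw (p : Kernel (X × A) X) (π : Strategy X A) (x0 : X)
    (n : ℕ) {f : X × A → ℝ≥0∞} (hf : Measurable f) :
    ∫⁻ z, f z ∂(pairLaw p π x0 n) =
      ∫⁻ h, ∫⁻ a, f (h.2, a) ∂(π.1 n h) ∂(histLaw p π x0 n) := by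
  have := π.2 n
  have hc : ∀ h : Hist X A n, Measurable fun a : A => (h.2, a) := fun h => measurable_prodMk_left
  have hm : Measurable fun h : Hist X A n => ((π.1 n) h).map fun a => (h.2, a) := by
    refine Measure.measurable_of_measurable_coe _ fun s hs => ?_
    have hs' : MeasurableSet ((fun q : Hist X A n × A => (q.1.2, q.2)) ⁻¹' s) := by
      have : Measurable fun q : Hist X A n × A => (q.1.2, q.2) := by fun_prop
      exact this hs
    have : ∀ h : Hist X A n, (((π.1 n) h).map fun a => (h.2, a)) s =
        π.1 n h (Prod.mk h ⁻¹' ((fun q : Hist X A n × A => (q.1.2, q.2)) ⁻¹' s)) := by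
      intro h
      rw [Measure.map_apply (hc h) hs]
      rfl
    simp only [this]
    exact Kernel.measurable_kernel_prodMk_left hs'
  rw [pairLaw, Measure.lintegral_bind hm.aemeasurable hf.aemeasurable]
  exact lintegral_congr fun h => lintegral_map hf (hc h)

theorem lintegral_histLaw_succ (p : Kernel (X × A) X) [IsMarkovKernel p] (π : Strategy X A)
    (x0 : X) (n : ℕ) {f : X → ℝ≥0∞} (hf : Measurable f) :
    ∫⁻ h, f h.2 ∂(histLaw p π x0 (n + 1)) =
      ∫⁻ z, ∫⁻ x, f x ∂(p z) ∂(pairLaw p π x0 n) := by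
  have hf2 : Measurable fun h : Hist X A (n + 1) => f h.2 := hf.comp measurable_snd
  rw [lintegral_pairLaw p π x0 n hf.lintegral_kernel, histLaw,
    Measure.lintegral_bind (measurable_hist_step p π n).aemeasurable hf2.aemeasurable]
  refine lintegral_congr fun h => ?_
  have hm : Measurable fun a : A =>
      (p (h.2, a)).map fun x' => ((Fin.snoc h.1 (h.2, a), x') : Hist X A (n + 1)) :=
    (measurable_transition_map p n).comp measurable_prodMk_left
  rw [Measure.lintegral_bind hm.aemeasurable hf2.aemeasurable]
  exact lintegral_congr fun a => lintegral_map hf2 (measurable_histSnoc_right h a)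

theorem lintegral_pairLaw_fst (p : Kernel (X × A) X) (π : Strategy X A) (x0 : X)
    (n : ℕ) {f : X → ℝ≥0∞} (hf : Measurable f) :
    ∫⁻ z, f z.1 ∂(pairLaw p π x0 n) = ∫⁻ h, f h.2 ∂(histLaw p π x0 n) := by
  have := π.2 n
  have hf1 : Measurable fun z : X × A => f z.1 := hf.comp measurable_fst
  rw [lintegral_pairLaw p π x0 n hf1]
  simp

theorem lintegral_histLaw_zero (p : Kernel (X × A) X) (π : Strategy X A) (x0 : X)
    {f : X → ℝ≥0∞} (hf : Measurable f) :
    ∫⁻ h, f h.2 ∂(histLaw p π x0 0) = f x0 := by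
  have hf2 : Measurable fun h : Hist X A 0 => f h.2 := hf.comp measurable_snd
  rw [histLaw, lintegral_dirac' _ hf2]

theorem histLaw_congr (p : Kernel (X × A) X) (π π' : Strategy X A) (x0 : X) (n : ℕ)
    (h : ∀ k < n, π.1 k = π'.1 k) : histLaw p π x0 n = histLaw p π' x0 n := by
  induction n with
  | zero => rfl
  | succ n ih =>
    rw [histLaw, histLaw, ih fun k hk => h k (by omega), h n (by omega)]

end HistoryLaws

section UniformAbsorption

variable {Y A : Type*} [MeasurableSpace Y] [MeasurableSpace A]

/-- The indicator of the non-cemetery states. -/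
def aliveIndicator (Y : Type*) : Y ⊕ Unit → ℝ≥0∞ := Sum.elim (fun _ => 1) fun _ => 0

theorem aliveIndicator_le_one {Y : Type*} (x : Y ⊕ Unit) : aliveIndicator Y x ≤ 1 := by
  rcases x with y | u <;> simp [aliveIndicator]

theorem measurable_aliveIndicator : Measurable (aliveIndicator Y) :=
  measurable_const.sumElim measurable_const

theorem measurableEmbedding_alivePair :
    MeasurableEmbedding fun ya : Y × A => ((Sum.inl ya.1, ya.2) : (Y ⊕ Unit) × A) :=
  (MeasurableEmbedding.mk Sum.inl_injective measurable_inl fun _ hs =>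
    MeasurableSet.inl_image hs).prodMap
    MeasurableEmbedding.id

/-- The occupation measure restricted to the stages from `n` on. -/
def tailOccupation (p : Kernel ((Y ⊕ Unit) × A) (Y ⊕ Unit)) (π : Strategy (Y ⊕ Unit) A)
    (x0 : Y ⊕ Unit) (n : ℕ) : Measure (Y × A) :=
  Measure.sum fun t => (pairLaw p π x0 (n + t)).comap fun ya : Y × A => (Sum.inl ya.1, ya.2)

theorem tailOccupation_zero (p : Kernel ((Y ⊕ Unit) × A) (Y ⊕ Unit)) (π : Strategy (Y ⊕ Unit) A)
    (x0 : Y ⊕ Unit) : tailOccupation p π x0 0 = occupation p π x0 := by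
  simp [tailOccupation, occupation]

theorem tailOccupation_le_occupation (p : Kernel ((Y ⊕ Unit) × A) (Y ⊕ Unit))
    (π : Strategy (Y ⊕ Unit) A) (x0 : Y ⊕ Unit) (n : ℕ) :
    tailOccupation p π x0 n ≤ occupation p π x0 := by
  refine Measure.le_intro fun s hs _ => ?_
  rw [tailOccupation, occupation, Measure.sum_apply _ hs, Measure.sum_apply _ hs]
  exact ENNReal.tsum_comp_le_tsum_of_injective (add_right_injective n)
    fun t => (pairLaw p π x0 t).comap (fun ya : Y × A => (Sum.inl ya.1, ya.2)) s

theorem lintegral_tailOccupation (p : Kernel ((Y ⊕ Unit) × A) (Y ⊕ Unit))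
    (π : Strategy (Y ⊕ Unit) A) (x0 : Y ⊕ Unit) (n : ℕ) {f : (Y ⊕ Unit) × A → ℝ≥0∞}
    (h0 : ∀ a, f (Sum.inr (), a) = 0) :
    ∫⁻ z, f (Sum.inl z.1, z.2) ∂(tailOccupation p π x0 n) =
      ∑' t, ∫⁻ z, f z ∂(pairLaw p π x0 (n + t)) := by
  rw [tailOccupation, lintegral_sum_measure]
  refine tsum_congr fun t => ?_
  have hE := measurableEmbedding_alivePair (Y := Y) (A := A)
  rw [← hE.lintegral_map f, hE.map_comap, ← lintegral_indicator hE.measurableSet_range]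
  congr 1
  refine Set.indicator_eq_self.2 fun z hz => ?_
  rcases z with ⟨y | u, a⟩
  · exact ⟨(y, a), rfl⟩
  · exact absurd (h0 a) hz

theorem survive_eq_lintegral (p : Kernel ((Y ⊕ Unit) × A) (Y ⊕ Unit))
    (π : Strategy (Y ⊕ Unit) A) (x0 : Y ⊕ Unit) (t : ℕ) :
    survive p π x0 t = ∫⁻ z, aliveIndicator Y z.1 ∂(pairLaw p π x0 t) := by
  have hs : MeasurableSet {z : (Y ⊕ Unit) × A | ∃ y : Y, z.1 = Sum.inl y} := by
    have : {z : (Y ⊕ Unit) × A | ∃ y : Y, z.1 = Sum.inl y} =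
        Prod.fst ⁻¹' (Set.range (Sum.inl : Y → Y ⊕ Unit)) := by
      ext z; simp [eq_comm]
    rw [this]
    exact measurable_fst measurableSet_range_inl
  rw [survive, ← lintegral_indicator_one hs]
  refine lintegral_congr fun z => ?_
  rcases z with ⟨y | u, a⟩ <;> simp [aliveIndicator, Set.indicator]

theorem tailOccupation_prod_univ (p : Kernel ((Y ⊕ Unit) × A) (Y ⊕ Unit))
    (π : Strategy (Y ⊕ Unit) A) (x0 : Y ⊕ Unit) (n : ℕ) {B : Set Y} (hB : MeasurableSet B) :
    tailOccupation p π x0 n (B ×ˢ Set.univ) =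
      ∑' t, ∫⁻ z, Sum.elim (B.indicator 1) (fun _ => 0) z.1 ∂(pairLaw p π x0 (n + t)) := by
  rw [← lintegral_tailOccupation p π x0 n
    (f := fun z => Sum.elim (B.indicator 1) (fun _ => 0) z.1) (fun a => rfl),
    ← lintegral_indicator_one (hB.prod MeasurableSet.univ)]
  refine lintegral_congr fun z => ?_
  by_cases hz : z.1 ∈ B <;> simp [Set.indicator, hz]

theorem tailOccupation_univ (p : Kernel ((Y ⊕ Unit) × A) (Y ⊕ Unit))
    (π : Strategy (Y ⊕ Unit) A) (x0 : Y ⊕ Unit) (n : ℕ) :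
    tailOccupation p π x0 n Set.univ = ∑' t, survive p π x0 (n + t) := by
  rw [← Set.univ_prod_univ, tailOccupation_prod_univ p π x0 n MeasurableSet.univ]
  refine tsum_congr fun t => ?_
  rw [survive_eq_lintegral]
  refine lintegral_congr fun z => ?_
  rcases z with ⟨y | u, a⟩ <;> simp [aliveIndicator]

/-- The maximal expected value of `f` after `t` further steps. -/
def maxExpected {X : Type*} [MeasurableSpace X] (p : Kernel (X × A) X) (f : X → ℝ≥0∞) :
    ℕ → X → ℝ≥0∞
  | 0 => f
  | t + 1 => fun x => ⨆ a, ∫⁻ x', maxExpected p f t x' ∂(p (x, a))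

section General

variable {X : Type*} [MeasurableSpace X]

theorem continuous_lintegral_of_conditionS [TopologicalSpace A] {p : Kernel (X × A) X}
    [IsMarkovKernel p] (hS : ConditionS p) {f : X → ℝ≥0∞} (hf : Measurable f)
    (h1 : ∀ x, f x ≤ 1) (x : X) : Continuous fun a => ∫⁻ x', f x' ∂(p (x, a)) := by
  have hc := hS.2 (fun x => (f x).toReal) hf.ennreal_toReal ⟨1, fun y => by
    rw [abs_of_nonneg ENNReal.toReal_nonneg]
    simpa using ENNReal.toReal_mono ENNReal.one_ne_top (h1 y)⟩ x
  convert ENNReal.continuous_ofReal.comp hc using 2 with a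
  have hle : ∫⁻ x', f x' ∂(p (x, a)) ≤ 1 := (lintegral_mono h1).trans (by simp)
  simp only [Function.comp]
  rw [integral_toReal hf.aemeasurable (ae_of_all _ fun y => (h1 y).trans_lt ENNReal.one_lt_top),
    ENNReal.ofReal_toReal (hle.trans_lt ENNReal.one_lt_top).ne]

theorem maxExpected_le_one {p : Kernel (X × A) X} [IsMarkovKernel p]
    {f : X → ℝ≥0∞} (h1 : ∀ x, f x ≤ 1) (t : ℕ) (x : X) : maxExpected p f t x ≤ 1 := by
  induction t generalizing x with
  | zero => exact h1 x
  | succ t ih => exact iSup_le fun a => (lintegral_mono ih).trans (by simp)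

theorem maxExpected_mono {p : Kernel (X × A) X} {f g : X → ℝ≥0∞} (h : f ≤ g) (t : ℕ) :
    maxExpected p f t ≤ maxExpected p g t := by
  induction t with
  | zero => exact h
  | succ t ih => exact fun x => iSup_mono fun a => lintegral_mono ih

variable [TopologicalSpace A]

theorem measurable_maxExpected [SecondCountableTopology A] {p : Kernel (X × A) X}
    [IsMarkovKernel p] (hS : ConditionS p) {f : X → ℝ≥0∞} (hf : Measurable f)
    (h1 : ∀ x, f x ≤ 1) (t : ℕ) : Measurable (maxExpected p f t) := by
  induction t with
  | zero => exact hf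
  | succ t ih =>
    obtain ⟨D, hDc, hDd⟩ := TopologicalSpace.exists_countable_dense A
    have hcont := continuous_lintegral_of_conditionS hS ih (maxExpected_le_one h1 t)
    have : maxExpected p f (t + 1) =
        fun x => ⨆ a ∈ D, ∫⁻ x', maxExpected p f t x' ∂(p (x, a)) := by
      funext x
      refine le_antisymm (iSup_le fun a => ?_) (iSup₂_le fun a _ => le_iSup
        (fun a => ∫⁻ x', maxExpected p f t x' ∂(p (x, a))) a)
      have hcl : IsClosed {a | ∫⁻ x', maxExpected p f t x' ∂(p (x, a)) ≤
          ⨆ a ∈ D, ∫⁻ x', maxExpected p f t x' ∂(p (x, a))} :=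
        isClosed_le (hcont x) continuous_const
      exact hcl.closure_subset_iff.2 (fun a ha => le_iSup₂
        (f := fun a (_ : a ∈ D) => ∫⁻ x', maxExpected p f t x' ∂(p (x, a))) a ha) (hDd a)
    rw [this]
    refine Measurable.biSup _ hDc fun a _ => ?_
    exact (ih.lintegral_kernel (κ := p)).comp measurable_prodMk_right

theorem iInf_maxExpected [SecondCountableTopology A] {p : Kernel (X × A) X}
    [IsMarkovKernel p] (hS : ConditionS p) {f : ℕ → X → ℝ≥0∞} (hf : ∀ k, Measurable (f k))
    (h1 : ∀ k x, f k x ≤ 1) (hanti : Antitone f) (h0 : ∀ x, ⨅ k, f k x = 0) (t : ℕ) (x : X) :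
    ⨅ k, maxExpected p (f k) t x = 0 := by
  induction t generalizing x with
  | zero => exact h0 x
  | succ t ih =>
    have := hS.1
    have hm := fun k => measurable_maxExpected hS (hf k) (h1 k) t
    have hanti' : Antitone fun k => maxExpected p (f k) t :=
      fun a b hab => maxExpected_mono (hanti hab) t
    have hpt : ∀ a, ⨅ k, ∫⁻ x', maxExpected p (f k) t x' ∂(p (x, a)) = 0 := by
      intro a
      rw [← lintegral_iInf hm hanti']
      · simp [ih]
      · exact ((lintegral_mono (maxExpected_le_one (h1 0) t)).trans_lt (by simp)).ne
    refine le_antisymm (ENNReal.le_of_forall_pos_le_add fun ε hε _ => ?_) zero_le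
    obtain ⟨k, hk⟩ := (isCompact_univ (X := A)).elim_directed_cover
      (fun k => {a | ∫⁻ x', maxExpected p (f k) t x' ∂(p (x, a)) < ε})
      (fun k => isOpen_lt (continuous_lintegral_of_conditionS hS (hm k)
        (maxExpected_le_one (h1 k) t) x) continuous_const)
      (fun a _ => by
        have : ⨅ k, ∫⁻ x', maxExpected p (f k) t x' ∂(p (x, a)) < ε := by
          rw [hpt a]; exact_mod_cast hε
        exact Set.mem_iUnion.2 (iInf_lt_iff.1 this))
      (Monotone.directed_le fun i j hij a ha =>
        lt_of_le_of_lt (lintegral_mono (hanti' hij)) ha)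
    refine iInf_le_of_le k ?_
    rw [zero_add]
    exact iSup_le fun a => (hk (Set.mem_univ a)).le

theorem lintegral_pairLaw_le_maxExpected [SecondCountableTopology A]
    {p : Kernel (X × A) X} [IsMarkovKernel p] (hS : ConditionS p) {f : X → ℝ≥0∞}
    (hf : Measurable f) (h1 : ∀ x, f x ≤ 1) (π : Strategy X A) (x0 : X) (t : ℕ) :
    ∫⁻ z, f z.1 ∂(pairLaw p π x0 t) ≤ maxExpected p f t x0 := by
  have key : ∀ t s, ∫⁻ h, maxExpected p f s h.2 ∂(histLaw p π x0 t) ≤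
      maxExpected p f (s + t) x0 := by
    intro t
    induction t with
    | zero =>
      intro s
      exact (lintegral_histLaw_zero p π x0 (measurable_maxExpected hS hf h1 s)).le
    | succ t ih =>
      intro s
      rw [lintegral_histLaw_succ p π x0 t (measurable_maxExpected hS hf h1 s)]
      have e : s + (t + 1) = (s + 1) + t := by omega
      rw [e]
      refine le_trans ?_ (ih (s + 1))
      rw [← lintegral_pairLaw_fst p π x0 t (measurable_maxExpected hS hf h1 (s + 1))]
      exact lintegral_mono fun z =>
        le_iSup (fun a => ∫⁻ x', maxExpected p f s x' ∂(p (z.1, a))) z.2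
  rw [lintegral_pairLaw_fst p π x0 t hf]
  have h0 := key t 0
  rwa [zero_add] at h0

end General

theorem survive_le_one [TopologicalSpace A] [SecondCountableTopology A]
    {p : Kernel ((Y ⊕ Unit) × A) (Y ⊕ Unit)} [IsMarkovKernel p] (hS : ConditionS p)
    (π : Strategy (Y ⊕ Unit) A) (x0 : Y ⊕ Unit) (t : ℕ) : survive p π x0 t ≤ 1 := by
  rw [survive_eq_lintegral]
  exact (lintegral_pairLaw_le_maxExpected hS measurable_aliveIndicator
    aliveIndicator_le_one π x0 t).trans
    (maxExpected_le_one aliveIndicator_le_one t x0)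

/-- Uniform absorption makes the total masses bounded and the state marginals of the occupation
measures uniformly countably additive. -/
theorem IsUnifAbsorbing.uniformly_countably_additive [TopologicalSpace A]
    [SecondCountableTopology A] {p : Kernel ((Y ⊕ Unit) × A) (Y ⊕ Unit)} [IsMarkovKernel p]
    (hS : ConditionS p) {Λ : Set (Strategy (Y ⊕ Unit) A)} {x0 : Y ⊕ Unit}
    (h : IsUnifAbsorbing p Λ x0) :
    (∃ C : NNReal, ∀ π ∈ Λ, occupation p π x0 Set.univ ≤ C) ∧
    ∀ B : ℕ → Set Y, Antitone B → (∀ n, MeasurableSet (B n)) → ⋂ n, B n = ∅ →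
      ∀ ε : ℝ≥0∞, ε ≠ 0 → ∃ k, ∀ π ∈ Λ, occupation p π x0 (B k ×ˢ Set.univ) ≤ ε := by
  rw [IsUnifAbsorbing, ENNReal.tendsto_atTop_zero] at h
  have htail : ∀ ε : ℝ≥0∞, ε ≠ 0 → ∃ N : ℕ, ∀ π ∈ Λ, ∑' t, survive p π x0 (N + t) ≤ ε := by
    intro ε hε
    obtain ⟨N, hN⟩ := h ε (pos_iff_ne_zero.2 hε)
    exact ⟨N, fun π hπ => (le_iSup₂ (f := fun π (_ : π ∈ Λ) => ∑' t, survive p π x0 (N + t))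
      π hπ).trans (hN N le_rfl)⟩
  constructor
  · obtain ⟨N, hN⟩ := htail 1 one_ne_zero
    refine ⟨N + 1, fun π hπ => ?_⟩
    rw [← tailOccupation_zero, tailOccupation_univ]
    simp only [zero_add]
    rw [← Summable.sum_add_tsum_nat_add' (k := N) ENNReal.summable]
    push_cast
    refine add_le_add ?_ ?_
    · refine (Finset.sum_le_sum fun t _ => survive_le_one hS π x0 t).trans ?_
      simp
    · simpa only [add_comm] using hN π hπ
  · intro B hB1 hB2 hB3 ε hε
    obtain ⟨N, hN⟩ := htail (ε / 2) (by simpa using hε)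
    let f : ℕ → Y ⊕ Unit → ℝ≥0∞ := fun k => Sum.elim ((B k).indicator 1) fun _ => 0
    have hfm : ∀ k, Measurable (f k) := fun k =>
      (measurable_one.indicator (hB2 k)).sumElim measurable_const
    have hf1 : ∀ k x, f k x ≤ 1 := by
      rintro k (y | u)
      · by_cases hy : y ∈ B k <;> simp [f, hy]
      · simp [f]
    have hfa : ∀ k x, f k x ≤ aliveIndicator Y x := by
      rintro k (y | u)
      · simpa [aliveIndicator] using hf1 k (Sum.inl y)
      · simp [f]
    have hanti : Antitone f := by
      rintro i j hij (y | u)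
      · exact Set.indicator_le_indicator_of_subset (hB1 hij) (fun _ => zero_le) y
      · exact le_rfl
    have hf0 : ∀ x, ⨅ k, f k x = 0 := by
      rintro (y | u)
      · have : y ∉ ⋂ k, B k := by simp [hB3]
        obtain ⟨k, hk⟩ := not_forall.1 (fun h => this (Set.mem_iInter.2 h))
        exact le_antisymm (iInf_le_of_le k (by simp [f, hk])) zero_le
      · simp [f]
    have hlim : Tendsto (fun k => ∑ t ∈ Finset.range N, maxExpected p (f k) t x0) atTop (𝓝 0) := by
      have := tendsto_finsetSum (Finset.range N) fun t _ =>
        tendsto_atTop_iInf (f := fun k => maxExpected p (f k) t x0)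
          fun i j hij => maxExpected_mono (hanti hij) t x0
      simpa [iInf_maxExpected hS hfm hf1 hanti hf0] using this
    obtain ⟨k, hk⟩ := (hlim.eventually_le_const
      (show (0 : ℝ≥0∞) < ε / 2 by simpa [pos_iff_ne_zero] using hε)).exists
    refine ⟨k, fun π hπ => ?_⟩
    rw [← tailOccupation_zero, tailOccupation_prod_univ p π x0 0 (hB2 k)]
    simp only [zero_add]
    rw [← Summable.sum_add_tsum_nat_add' (k := N) ENNReal.summable, ← ENNReal.add_halves ε]
    refine add_le_add ?_ ?_
    · exact (Finset.sum_le_sum fun t _ =>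
        lintegral_pairLaw_le_maxExpected hS (hfm k) (hf1 k) π x0 t).trans hk
    · refine (ENNReal.tsum_le_tsum fun t => ?_).trans (hN π hπ)
      rw [survive_eq_lintegral, add_comm]
      exact lintegral_mono fun z => hfa k z.1

end UniformAbsorption

section Invariance

variable {X Y A : Type*} [MeasurableSpace X] [MeasurableSpace Y] [MeasurableSpace A]

/-- The strategy that follows `π` before stage `t` and the stationary policy `φ` afterwards. -/
def Strategy.thenStationary (π : Strategy X A) (t : ℕ) (φ : Kernel X A) [IsMarkovKernel φ] :
    Strategy X A :=
  ⟨fun k => if k < t then π.1 k else φ.comap Prod.snd measurable_snd, fun k => by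
    have := π.2 k
    beta_reduce
    split_ifs <;> infer_instance⟩

/-- The expected value of `f` after `n` further steps under the stationary policy `φ`. -/
def stationaryExpected (p : Kernel (X × A) X) (φ : Kernel X A) (f : X → ℝ≥0∞) : ℕ → X → ℝ≥0∞
  | 0 => f
  | n + 1 => fun x => ∫⁻ a, ∫⁻ x', stationaryExpected p φ f n x' ∂(p (x, a)) ∂(φ x)

theorem measurable_stationaryExpected (p : Kernel (X × A) X) (φ : Kernel X A) [IsMarkovKernel φ]
    {f : X → ℝ≥0∞} (hf : Measurable f) (n : ℕ) : Measurable (stationaryExpected p φ f n) := by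
  induction n with
  | zero => exact hf
  | succ n ih => exact (ih.lintegral_kernel (κ := p)).lintegral_kernel_prod_right'

theorem stationaryExpected_le_one (p : Kernel (X × A) X) [IsMarkovKernel p] (φ : Kernel X A)
    [IsMarkovKernel φ] {f : X → ℝ≥0∞} (h1 : ∀ x, f x ≤ 1) (n : ℕ) (x : X) :
    stationaryExpected p φ f n x ≤ 1 := by
  induction n generalizing x with
  | zero => exact h1 x
  | succ n ih =>
    have h : ∀ a, ∫⁻ x', stationaryExpected p φ f n x' ∂(p (x, a)) ≤ 1 :=
      fun a => (lintegral_mono ih).trans (by simp)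
    exact (lintegral_mono h).trans (by simp)

theorem lintegral_histLaw_thenStationary (p : Kernel (X × A) X) [IsMarkovKernel p]
    (π : Strategy X A) (φ : Kernel X A) [IsMarkovKernel φ] (x0 : X) {f : X → ℝ≥0∞}
    (hf : Measurable f) (t n : ℕ) :
    ∫⁻ h, f h.2 ∂(histLaw p (π.thenStationary t φ) x0 (t + n)) =
      ∫⁻ h, stationaryExpected p φ f n h.2 ∂(histLaw p π x0 t) := by
  have key : ∀ n s, ∫⁻ h, stationaryExpected p φ f s h.2
      ∂(histLaw p (π.thenStationary t φ) x0 (t + n)) =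
      ∫⁻ h, stationaryExpected p φ f (s + n) h.2 ∂(histLaw p π x0 t) := by
    intro n
    induction n with
    | zero =>
      intro s
      rw [add_zero, add_zero, histLaw_congr p (π.thenStationary t φ) π x0 t fun k hk => by
        simp [Strategy.thenStationary, hk]]
    | succ n ih =>
      intro s
      have hm := measurable_stationaryExpected p φ hf s
      rw [← add_assoc t n 1, lintegral_histLaw_succ p _ x0 _ hm,
        lintegral_pairLaw p _ x0 _ hm.lintegral_kernel,
        show s + (n + 1) = (s + 1) + n by omega, ← ih (s + 1)]
      refine lintegral_congr fun h => ?_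
      have : (π.thenStationary t φ).1 (t + n) = φ.comap Prod.snd measurable_snd := by
        simp [Strategy.thenStationary]
      rw [this, Kernel.comap_apply]
      rfl
  have h0 := key n 0
  rwa [zero_add] at h0

theorem lintegral_eq_zero_of_cemetery {p : Kernel ((Y ⊕ Unit) × A) (Y ⊕ Unit)} [IsMarkovKernel p]
    (hcem : ∀ a : A, p (Sum.inr (), a) {(Sum.inr () : Y ⊕ Unit)} = 1) {f : Y ⊕ Unit → ℝ≥0∞}
    (h0 : f (Sum.inr ()) = 0) (a : A) : ∫⁻ x, f x ∂(p (Sum.inr (), a)) = 0 := by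
  have hs : MeasurableSet {(Sum.inr () : Y ⊕ Unit)} := by
    rw [← Set.image_singleton]
    exact MeasurableSet.inr_image (MeasurableSet.singleton ())
  have hc := (prob_compl_eq_zero_iff hs).2 (hcem a)
  refine lintegral_eq_zero_of_ae_eq_zero ?_
  filter_upwards [compl_mem_ae_iff.2 hc] with x hx
  rw [compl_compl] at hx
  rw [Set.mem_singleton_iff.1 hx, h0, Pi.zero_apply]

theorem antitone_survive {p : Kernel ((Y ⊕ Unit) × A) (Y ⊕ Unit)} [IsMarkovKernel p]
    (hcem : ∀ a : A, p (Sum.inr (), a) {(Sum.inr () : Y ⊕ Unit)} = 1)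
    (π : Strategy (Y ⊕ Unit) A) (x0 : Y ⊕ Unit) : Antitone (survive p π x0) := by
  refine antitone_nat_of_succ_le fun t => ?_
  rw [survive_eq_lintegral, survive_eq_lintegral,
    lintegral_pairLaw_fst p π x0 (t + 1) measurable_aliveIndicator,
    lintegral_histLaw_succ p π x0 t measurable_aliveIndicator]
  refine lintegral_mono fun z => ?_
  rcases z with ⟨y | u, a⟩
  · exact (lintegral_mono aliveIndicator_le_one).trans (by simp [aliveIndicator])
  · exact (lintegral_eq_zero_of_cemetery hcem rfl a).trans_le zero_le

theorem survive_le_div {p : Kernel ((Y ⊕ Unit) × A) (Y ⊕ Unit)} [IsMarkovKernel p]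
    (hcem : ∀ a : A, p (Sum.inr (), a) {(Sum.inr () : Y ⊕ Unit)} = 1)
    (π : Strategy (Y ⊕ Unit) A) (x0 : Y ⊕ Unit) (n : ℕ) :
    survive p π x0 n ≤ (∑' t, survive p π x0 t) / (n + 1) := by
  rw [ENNReal.le_div_iff_mul_le (Or.inl (by simp)) (Or.inl (by finiteness))]
  refine le_trans ?_ (ENNReal.sum_le_tsum (Finset.range (n + 1)))
  have := Finset.card_nsmul_le_sum (Finset.range (n + 1)) (survive p π x0) (survive p π x0 n)
    fun t ht => antitone_survive hcem π x0 (by simpa [Nat.lt_succ_iff] using ht)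
  rw [Finset.card_range, nsmul_eq_mul, mul_comm] at this
  exact_mod_cast this

/-- In an absorbing model, no strategy can reach a set on which some stationary policy survives
forever. -/
theorem lintegral_histLaw_eq_zero_of_stationary {p : Kernel ((Y ⊕ Unit) × A) (Y ⊕ Unit)}
    [IsMarkovKernel p] {x0 : Y ⊕ Unit} (habs : IsAbsorbing p x0) (φ : Kernel (Y ⊕ Unit) A)
    [IsMarkovKernel φ] {f : Y ⊕ Unit → ℝ≥0∞}
    (hfS : ∀ n x, f x ≤ stationaryExpected p φ (aliveIndicator Y) n x)
    (π : Strategy (Y ⊕ Unit) A) (t : ℕ) : ∫⁻ h, f h.2 ∂(histLaw p π x0 t) = 0 := by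
  by_contra hne
  refine (habs (π.thenStationary t φ)).ne (top_unique ?_)
  calc (⊤ : ℝ≥0∞) = ∑' _ : ℕ, ∫⁻ h, f h.2 ∂(histLaw p π x0 t) :=
        (ENNReal.tsum_const_eq_top_of_ne_zero hne).symm
    _ ≤ ∑' n, survive p (π.thenStationary t φ) x0 (t + n) := by
        refine ENNReal.tsum_le_tsum fun n => ?_
        rw [survive_eq_lintegral, lintegral_pairLaw_fst p _ x0 _ measurable_aliveIndicator,
          lintegral_histLaw_thenStationary p π φ x0 measurable_aliveIndicator]
        exact lintegral_mono fun h => hfS n h.2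
    _ ≤ ∑' s, survive p (π.thenStationary t φ) x0 s :=
        ENNReal.tsum_comp_le_tsum_of_injective (add_right_injective t) _

/-- An invariant measure of an absorbing model is carried by a set of states that no strategy can
reach. -/
theorem exists_unreachable_support [StandardBorelSpace A] [Nonempty A]
    {p : Kernel ((Y ⊕ Unit) × A) (Y ⊕ Unit)} [IsMarkovKernel p]
    (hcem : ∀ a : A, p (Sum.inr (), a) {(Sum.inr () : Y ⊕ Unit)} = 1) {x0 : Y ⊕ Unit}
    (habs : IsAbsorbing p x0) (ρ : Measure ((Y ⊕ Unit) × A)) [IsFiniteMeasure ρ]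
    (halive : ∀ᵐ z ∂ρ, z.1 ≠ Sum.inr ())
    (hinv : ∀ f : Y ⊕ Unit → ℝ≥0∞, Measurable f → (∀ x, f x ≤ 1) → f (Sum.inr ()) = 0 →
      ∫⁻ z, f z.1 ∂ρ = ∫⁻ z, ∫⁻ x, f x ∂(p z) ∂ρ) :
    ∃ S : Set (Y ⊕ Unit), MeasurableSet S ∧ Sum.inr () ∉ S ∧ (∀ᵐ z ∂ρ, z.1 ∈ S) ∧
      ∀ (π : Strategy (Y ⊕ Unit) A) (t : ℕ),
        ∫⁻ h, S.indicator 1 h.2 ∂(histLaw p π x0 t) = 0 := by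
  let φ := ρ.condKernel
  let u := stationaryExpected p φ (aliveIndicator Y)
  have hum : ∀ n, Measurable (u n) :=
    measurable_stationaryExpected p φ measurable_aliveIndicator
  have hu1 : ∀ n x, u n x ≤ 1 := stationaryExpected_le_one p φ aliveIndicator_le_one
  have hu0 : ∀ n, u n (Sum.inr ()) = 0 := by
    intro n
    induction n with
    | zero => rfl
    | succ n ih =>
      change ∫⁻ a, ∫⁻ x, u n x ∂(p (Sum.inr (), a)) ∂(φ (Sum.inr ())) = 0
      simp [lintegral_eq_zero_of_cemetery hcem ih]
  have hdis : ρ.fst ⊗ₘ φ = ρ := ρ.disintegrate ρ.condKernel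
  have htotal : ∀ n, ∫⁻ x, u n x ∂ρ.fst = ρ Set.univ := by
    intro n
    induction n with
    | zero =>
      rw [Measure.fst, lintegral_map (hum 0) measurable_fst, ← lintegral_one]
      refine lintegral_congr_ae ?_
      filter_upwards [halive] with z hz
      rcases z with ⟨y | v, a⟩
      · rfl
      · exact absurd rfl hz
    | succ n ih =>
      rw [← ih]
      change ∫⁻ x, ∫⁻ a, ∫⁻ x', u n x' ∂(p (x, a)) ∂(φ x) ∂ρ.fst = _
      rw [← Measure.lintegral_compProd (f := fun z => ∫⁻ x', u n x' ∂(p z))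
        (hum n).lintegral_kernel, hdis, ← hinv (u n) (hum n) (hu1 n) (hu0 n),
        Measure.fst, lintegral_map (hum n) measurable_fst]
  have hae : ∀ᵐ x ∂ρ.fst, ∀ n, u n x = 1 := by
    refine ae_all_iff.2 fun n => ?_
    have h := ae_eq_of_ae_le_of_lintegral_le (μ := ρ.fst) (f := u n) (g := fun _ => 1)
      (ae_of_all _ (hu1 n)) (by rw [htotal]; finiteness) aemeasurable_const
      (by rw [htotal, lintegral_one, Measure.fst_univ])
    exact h
  refine ⟨{x | ∀ n, u n x = 1}, ?_, fun h => ?_, ?_, ?_⟩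
  · rw [Set.ofPred_forall]
    exact MeasurableSet.iInter fun n => hum n (measurableSet_singleton 1)
  · have := h 0
    rw [hu0] at this
    exact zero_ne_one this
  · exact ae_of_ae_map measurable_fst.aemeasurable hae
  · refine fun π t => lintegral_histLaw_eq_zero_of_stationary habs φ (fun n x => ?_) π t
    refine Set.indicator_apply_le' (fun hx => ?_) fun _ => zero_le
    exact (hx n).ge

end Invariance

section UniformAbsorptionOfCompactness

variable {Y A : Type*} [MeasurableSpace Y] [MeasurableSpace A]

theorem tendsto_lintegral_of_tendsto_integral {ι Z : Type*} [MeasurableSpace Z] {l : Filter ι}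
    {θ : ι → FiniteMeasure Z} {η : FiniteMeasure Z} {f : Z → ℝ≥0∞} (hf : Measurable f)
    (h1 : ∀ z, f z ≤ 1)
    (h : Tendsto (fun i => ∫ z, (f z).toReal ∂(θ i : Measure Z)) l
      (𝓝 (∫ z, (f z).toReal ∂(η : Measure Z)))) :
    Tendsto (fun i => ∫⁻ z, f z ∂(θ i : Measure Z)) l (𝓝 (∫⁻ z, f z ∂(η : Measure Z))) := by
  have key : ∀ ν : FiniteMeasure Z, ENNReal.ofReal (∫ z, (f z).toReal ∂(ν : Measure Z)) =
      ∫⁻ z, f z ∂(ν : Measure Z) := fun ν => by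
    rw [integral_toReal hf.aemeasurable
      (ae_of_all _ fun z => (h1 z).trans_lt ENNReal.one_lt_top), ENNReal.ofReal_toReal]
    refine ((lintegral_mono h1).trans_lt ?_).ne
    rw [lintegral_one]
    finiteness
  simpa only [key, Function.comp_def] using (ENNReal.continuous_ofReal.tendsto _).comp h

theorem lintegral_tailOccupation_add (p : Kernel ((Y ⊕ Unit) × A) (Y ⊕ Unit)) [IsMarkovKernel p]
    (hcem : ∀ a : A, p (Sum.inr (), a) {(Sum.inr () : Y ⊕ Unit)} = 1)
    (π : Strategy (Y ⊕ Unit) A) (x0 : Y ⊕ Unit) (n : ℕ) {f : Y ⊕ Unit → ℝ≥0∞} (hf : Measurable f)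
    (h0 : f (Sum.inr ()) = 0) :
    ∫⁻ z, f (Sum.inl z.1) ∂(tailOccupation p π x0 n) =
      ∫⁻ z, f z.1 ∂(pairLaw p π x0 n) +
        ∫⁻ z, ∫⁻ x, f x ∂(p (Sum.inl z.1, z.2)) ∂(tailOccupation p π x0 n) := by
  rw [lintegral_tailOccupation p π x0 n (f := fun z => f z.1) (fun _ => h0),
    lintegral_tailOccupation p π x0 n (f := fun z => ∫⁻ x, f x ∂(p z))
      (lintegral_eq_zero_of_cemetery hcem h0),
    tsum_eq_zero_add' ENNReal.summable, add_zero]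
  congr 1
  refine tsum_congr fun t => ?_
  rw [← add_assoc, lintegral_pairLaw_fst p π x0 _ hf, lintegral_histLaw_succ p π x0 _ hf]

/-- Bounded masses and uniform countable additivity of the state marginals of the occupation
measures force uniform absorption. -/
theorem isUnifAbsorbing_of_uniformly_countably_additive [StandardBorelSpace Y]
    [TopologicalSpace A] [BorelSpace A] [TopologicalSpace.MetrizableSpace A]
    [SecondCountableTopology A] [StandardBorelSpace A] [Nonempty A]
    {p : Kernel ((Y ⊕ Unit) × A) (Y ⊕ Unit)} [IsMarkovKernel p]
    (hcem : ∀ a : A, p (Sum.inr (), a) {(Sum.inr () : Y ⊕ Unit)} = 1) {x0 : Y ⊕ Unit}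
    (habs : IsAbsorbing p x0) (hS : ConditionS p) {Λ : Set (Strategy (Y ⊕ Unit) A)}
    {C : NNReal} (hC : ∀ π ∈ Λ, occupation p π x0 Set.univ ≤ C)
    (huca : ∀ B : ℕ → Set Y, Antitone B → (∀ n, MeasurableSet (B n)) → ⋂ n, B n = ∅ →
      ∀ ε : ℝ≥0∞, ε ≠ 0 → ∃ k, ∀ π ∈ Λ, occupation p π x0 (B k ×ˢ Set.univ) ≤ ε) :
    IsUnifAbsorbing p Λ x0 := by
  have := hS.1
  rw [IsUnifAbsorbing, ENNReal.tendsto_atTop_zero]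
  by_contra! hcon
  obtain ⟨ε, hε, hcon⟩ := hcon
  have hex : ∀ N, ∃ n, N ≤ n ∧ ∃ π ∈ Λ, ε < ∑' t, survive p π x0 (n + t) := by
    intro N
    obtain ⟨n, hn, hlt⟩ := hcon N
    simp only [lt_iSup_iff] at hlt
    obtain ⟨π, hπ, hlt⟩ := hlt
    exact ⟨n, hn, π, hπ, hlt⟩
  choose n hn π hπ hlt using hex
  let τ : ℕ → Measure (Y × A) := fun N => tailOccupation p (π N) x0 (n N)
  have hτle : ∀ N, τ N ≤ occupation p (π N) x0 := fun N =>
    tailOccupation_le_occupation p (π N) x0 (n N)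
  have hτC : ∀ N, τ N Set.univ ≤ C := fun N => (hτle N _).trans (hC _ (hπ N))
  have hτfin : ∀ N, IsFiniteMeasure (τ N) := fun N => ⟨(hτC N).trans_lt ENNReal.coe_lt_top⟩
  let θ : ℕ → FiniteMeasure (Y × A) := fun N => ⟨τ N, hτfin N⟩
  obtain ⟨η, hη⟩ := exists_ws_limit (hyperfilter ℕ) θ C
    (Eventually.of_forall fun N => by
      rw [← ENNReal.coe_le_coe, FiniteMeasure.ennreal_mass]
      exact hτC N)
    fun B hB1 hB2 hB3 δ hδ => by
      obtain ⟨k, hk⟩ := huca B hB1 hB2 hB3 δ hδ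
      exact ⟨k, Eventually.of_forall fun N => (hτle N _).trans (hk _ (hπ N))⟩
  have hlim : ∀ f : Y × A → ℝ≥0∞, Measurable f → (∀ z, f z ≤ 1) →
      (∀ y, Continuous fun a => f (y, a)) →
      Tendsto (fun N => ∫⁻ z, f z ∂(τ N)) (hyperfilter ℕ)
        (𝓝 (∫⁻ z, f z ∂(η : Measure (Y × A)))) := by
    intro f hf h1 hc
    refine tendsto_lintegral_of_tendsto_integral (θ := θ) hf h1
      (hη _ hf.ennreal_toReal ⟨1, fun z => ?_⟩ fun y => ?_)
    · rw [abs_of_nonneg ENNReal.toReal_nonneg]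
      simpa using ENNReal.toReal_mono ENNReal.one_ne_top (h1 z)
    · exact ENNReal.continuousOn_toReal.comp_continuous (hc y) fun a =>
        ((h1 _).trans_lt ENNReal.one_lt_top).ne
  have hsurv : Tendsto (fun N => survive p (π N) x0 (n N)) (hyperfilter ℕ) (𝓝 0) := by
    have hz : Tendsto (fun N : ℕ => (C : ℝ≥0∞) / (N + 1)) atTop (𝓝 0) := by
      have := ENNReal.Tendsto.const_div (a := (C : ℝ≥0∞)) ((tendsto_add_atTop_iff_nat 1).2
        ENNReal.tendsto_nat_nhds_top) (Or.inr ENNReal.coe_ne_top)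
      simpa using this
    have hz' := hz.mono_left (Nat.hyperfilter_le_atTop)
    refine tendsto_of_tendsto_of_tendsto_of_le_of_le tendsto_const_nhds hz'
      (fun N => zero_le) fun N => ?_
    refine (survive_le_div hcem (π N) x0 (n N)).trans (ENNReal.div_le_div ?_ ?_)
    · have h := hC _ (hπ N)
      rw [← tailOccupation_zero, tailOccupation_univ] at h
      simpa using h
    · exact_mod_cast Nat.succ_le_succ (hn N)
  have hE := measurableEmbedding_alivePair (Y := Y) (A := A)
  let ρ : Measure ((Y ⊕ Unit) × A) :=
    (η : Measure (Y × A)).map fun ya => (Sum.inl ya.1, ya.2)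
  have hρ : ∀ f : (Y ⊕ Unit) × A → ℝ≥0∞,
      ∫⁻ z, f z ∂ρ = ∫⁻ z, f (Sum.inl z.1, z.2) ∂(η : Measure (Y × A)) := hE.lintegral_map
  obtain ⟨S, hSm, hS0, hSρ, hSπ⟩ := exists_unreachable_support hcem habs ρ
    (by
      refine hE.ae_map_iff.2 (ae_of_all _ fun z => ?_)
      simp)
    (fun f hf h1 h0 => by
      rw [hρ, hρ]
      have hm : Measurable fun z : Y × A => ∫⁻ x, f x ∂(p (Sum.inl z.1, z.2)) :=
        (hf.lintegral_kernel (κ := p)).comp hE.measurable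
      refine tendsto_nhds_unique (hlim (fun z => f (Sum.inl z.1))
        (hf.comp (measurable_inl.comp measurable_fst)) (fun _ => h1 _)
        fun y => continuous_const (y := f (Sum.inl y))) ?_
      simp only [τ, lintegral_tailOccupation_add p hcem _ x0 _ hf h0]
      rw [← zero_add (∫⁻ z, _ ∂(η : Measure (Y × A)))]
      refine Tendsto.add (tendsto_of_tendsto_of_tendsto_of_le_of_le tendsto_const_nhds hsurv
        (fun N => zero_le) fun N => ?_) (hlim _ hm
          (fun z => (lintegral_mono h1).trans (by simp))
          fun y => continuous_lintegral_of_conditionS hS hf h1 (Sum.inl y))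
      rw [survive_eq_lintegral]
      refine lintegral_mono fun z => ?_
      rcases z with ⟨y | u, a⟩
      · exact h1 _
      · exact h0.le)
  have hS1 : ∀ x, S.indicator (1 : Y ⊕ Unit → ℝ≥0∞) x ≤ 1 := fun x =>
    Set.indicator_apply_le' (fun _ => le_rfl) fun _ => zero_le
  have hind : Measurable (S.indicator (1 : Y ⊕ Unit → ℝ≥0∞)) := measurable_one.indicator hSm
  have hηS : ∫⁻ z, S.indicator 1 (Sum.inl z.1) ∂(η : Measure (Y × A)) = 0 := by
    refine tendsto_nhds_unique (hlim (fun z => S.indicator 1 (Sum.inl z.1))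
      (hind.comp (measurable_inl.comp measurable_fst)) (fun _ => hS1 _)
      fun y => continuous_const (y := S.indicator 1 (Sum.inl y))) ?_
    have hz : ∀ N, ∫⁻ z, S.indicator 1 (Sum.inl z.1) ∂(τ N) = 0 := fun N => by
      rw [lintegral_tailOccupation p (π N) x0 (n N) (f := fun z => S.indicator 1 z.1)
        (fun _ => Set.indicator_of_notMem hS0 _)]
      simp only [lintegral_pairLaw_fst p (π N) x0 _ hind, hSπ, tsum_zero]
    simp only [hz]
    exact tendsto_const_nhds
  have hηuniv : (η : Measure (Y × A)) Set.univ = 0 := by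
    rw [← hηS, ← lintegral_one]
    refine lintegral_congr_ae ?_
    filter_upwards [hE.ae_map_iff.1 hSρ] with z hz
    exact (Set.indicator_of_mem (f := (1 : Y ⊕ Unit → ℝ≥0∞)) hz).symm
  have hmass := hlim (fun _ => 1) measurable_const (fun _ => le_rfl) fun _ => continuous_const
  simp only [lintegral_one, hηuniv] at hmass
  obtain ⟨N, hN⟩ := (hmass.eventually_lt_const hε).exists
  refine absurd hN (not_lt.2 ?_)
  rw [tailOccupation_univ]
  exact (hlt N).le

end UniformAbsorptionOfCompactness

/-- Lemma 2 of the paper.  Under Condition (S), an absorbing MDP model with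
initial state `x0 ∈ Y` is `Λ`-uniformly absorbing iff `D^Λ_{x0}` is relatively ws-compact in
`M(Y × A)`. -/
theorem stmt1
    {Y A : Type*}
    [TopologicalSpace Y] [MeasurableSpace Y] [BorelSpace Y]
    [TopologicalSpace.MetrizableSpace Y] [SecondCountableTopology Y] [StandardBorelSpace Y]
    [Nonempty Y]
    [TopologicalSpace A] [MeasurableSpace A] [BorelSpace A]
    [TopologicalSpace.MetrizableSpace A] [SecondCountableTopology A] [StandardBorelSpace A]
    [Nonempty A]
    (p : Kernel ((Y ⊕ Unit) × A) (Y ⊕ Unit)) [IsMarkovKernel p]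
    (hcem : ∀ a : A, p (Sum.inr (), a) {(Sum.inr () : Y ⊕ Unit)} = 1)
    (y0 : Y)
    (habs : IsAbsorbing p (Sum.inl y0 : Y ⊕ Unit))
    (hS : ConditionS p)
    (Λ : Set (Strategy (Y ⊕ Unit) A)) (hΛ : Λ.Nonempty) :
    IsUnifAbsorbing p Λ (Sum.inl y0) ↔
      @IsCompact _ (wsTop Y A) (@closure _ (wsTop Y A) (OccSet p Λ (Sum.inl y0))) := by
  have := hS.1
  rw [isCompact_closure_wsTop_iff]
  have hfin : ∀ π, IsFiniteMeasure (occupation p π (Sum.inl y0)) := fun π => by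
    refine ⟨?_⟩
    rw [← tailOccupation_zero, tailOccupation_univ]
    simpa using habs π
  have hmem : ∀ π ∈ Λ, (⟨occupation p π (Sum.inl y0), hfin π⟩ : FiniteMeasure (Y × A)) ∈
      OccSet p Λ (Sum.inl y0) := fun π hπ => ⟨π, hπ, rfl⟩
  constructor
  · intro h
    obtain ⟨⟨C, hC⟩, huca⟩ := h.uniformly_countably_additive hS
    refine ⟨⟨C, ?_⟩, fun B hB1 hB2 hB3 ε hε => ?_⟩
    · rintro η ⟨π, hπ, hη⟩
      rw [hη]
      exact hC π hπ
    · obtain ⟨k, hk⟩ := huca B hB1 hB2 hB3 ε hε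
      refine ⟨k, ?_⟩
      rintro η ⟨π, hπ, hη⟩
      rw [hη]
      exact hk π hπ
  · rintro ⟨⟨C, hC⟩, huca⟩
    refine isUnifAbsorbing_of_uniformly_countably_additive hcem habs hS
      (fun π hπ => hC _ (hmem π hπ)) fun B hB1 hB2 hB3 ε hε => ?_
    obtain ⟨k, hk⟩ := huca B hB1 hB2 hB3 ε hε
    exact ⟨k, fun π hπ => hk _ (hmem π hπ)⟩

end
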